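/- For every positive integer d there exists q ∈ (0,1) such that 2^{h(q) + q^d} · binomial(2d, d)^{1/(2d)} > 3.6. -/

import Mathlib

/-- The binary entropy function `h(p) = −p·log₂ p − (1−p)·log₂(1−p)` (with `h(0) = h(1) = 0`,
using the convention `log₂ 0 = 0`). -/
noncomputable def binEnt (p : ℝ) : ℝ :=
  -p * Real.logb 2 p - (1 - p) * Real.logb 2 (1 - p)

/-- An inequality between natural numbers certifying that `q = a / (a + c)` works. -/
theorem binEnt_witness_of_pow_lt (d a c e k m : ℕ) (hd : 0 < d) (ha : 0 < a) (hc : 0 < c)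
    (hk : 0 < k) (hm : (a + c) * k = 2 * d * m)
    (he : e * (a + c) ^ d ≤ (a + c) * k * a ^ d)
    (h : 18 ^ ((a + c) * k) * a ^ (a * k) * c ^ (c * k) <
      5 ^ ((a + c) * k) * 2 ^ e * (a + c) ^ ((a + c) * k) * (2 * d).choose d ^ m) :
    ∃ q : ℝ, 0 < q ∧ q < 1 ∧
      (2 : ℝ) ^ (binEnt q + q ^ d) * ((Nat.choose (2 * d) d : ℝ)) ^ ((1 : ℝ) / (2 * d))
        > 3.6 := by
  have hC : 0 < (2 * d).choose d := Nat.choose_pos (by omega)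
  generalize (2 * d).choose d = C at h hC ⊢
  have hC' : (0 : ℝ) < C := by exact_mod_cast hC
  have hd' : (0 : ℝ) < d := by exact_mod_cast hd
  have ha' : (0 : ℝ) < a := by exact_mod_cast ha
  have hc' : (0 : ℝ) < c := by exact_mod_cast hc
  have hk' : (0 : ℝ) < k := by exact_mod_cast hk
  have hb' : (0 : ℝ) < a + c := by positivity
  have hm' : ((a : ℝ) + c) * k = 2 * d * m := by exact_mod_cast hm
  have he' : (e : ℝ) ≤ (a + c) * k * (a / (a + c)) ^ d := by
    rw [div_pow, ← mul_div_assoc, le_div_iff₀ (by positivity)]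
    exact_mod_cast he
  refine ⟨a / (a + c), by positivity, by rw [div_lt_one hb']; linarith, ?_⟩
  have hlog2 : 0 < Real.log 2 := Real.log_pos (by norm_num)
  have hent : (a + c) * k * (binEnt (a / (a + c)) * Real.log 2) =
      (a + c) * k * Real.log (a + c) - a * k * Real.log a - c * k * Real.log c := by
    have hsub : 1 - (a : ℝ) / (a + c) = c / (a + c) := by field_simp; ring
    rw [binEnt, hsub, Real.logb, Real.logb, Real.log_div ha'.ne' hb'.ne',
      Real.log_div hc'.ne' hb'.ne']
    field_simp
    ring
  have hcert : (a + c) * k * Real.log 18 + a * k * Real.log a + c * k * Real.log c <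
      (a + c) * k * Real.log 5 + e * Real.log 2 + (a + c) * k * Real.log (a + c)
        + m * Real.log C := by
    have h' : (18 : ℝ) ^ ((a + c) * k) * a ^ (a * k) * c ^ (c * k) <
        5 ^ ((a + c) * k) * 2 ^ e * (a + c) ^ ((a + c) * k) * C ^ m := by exact_mod_cast h
    have := Real.log_lt_log (by positivity) h'
    rw [Real.log_mul (by positivity) (by positivity), Real.log_mul (by positivity) (by positivity),
      Real.log_mul (by positivity) (by positivity), Real.log_mul (by positivity) (by positivity),
      Real.log_mul (by positivity) (by positivity)] at this
    simpa only [Real.log_pow, Nat.cast_mul, Nat.cast_add] using this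
  have h36 : Real.log 3.6 = Real.log 18 - Real.log 5 := by
    rw [← Real.log_div (by norm_num) (by norm_num)]
    norm_num
  have hroot : (a + c) * k * (1 / (2 * d) * Real.log C) = m * Real.log C := by
    rw [hm']
    field_simp
  rw [gt_iff_lt, ← Real.log_lt_log_iff (by norm_num) (by positivity),
    Real.log_mul (by positivity) (by positivity), Real.log_rpow (by norm_num),
    Real.log_rpow hC', h36]
  have hN : (0 : ℝ) < (a + c) * k := by positivity
  refine lt_of_mul_lt_mul_left ?_ hN.le
  nlinarith [mul_le_mul_of_nonneg_right he' hlog2.le]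

theorem pow_lt_centralBinom (d : ℕ) (hd : 8 ≤ d) : (81 / 25 : ℝ) ^ d < d.centralBinom := by
  induction d, hd using Nat.le_induction with
  | base =>
    have : Nat.centralBinom 8 = 12870 := by decide
    rw [this]
    norm_num
  | succ d hd ih =>
    have hrec : ((d : ℝ) + 1) * (d + 1).centralBinom = 2 * (2 * d + 1) * d.centralBinom := by
      exact_mod_cast Nat.succ_mul_centralBinom_succ d
    have hd' : (8 : ℝ) ≤ d := by exact_mod_cast hd
    have hpos : (0 : ℝ) < (81 / 25) ^ d := by positivity
    refine lt_of_mul_lt_mul_left ?_ (show (0 : ℝ) ≤ d + 1 by positivity)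
    rw [hrec, pow_succ]
    nlinarith [mul_lt_mul_of_pos_left ih (show (0 : ℝ) < 2 * (2 * d + 1) by positivity)]

theorem binEnt_half : binEnt (1 / 2) = 1 := by
  have h : Real.logb 2 (1 / 2) = -1 := by
    rw [one_div, Real.logb_inv, Real.logb_self_eq_one (by norm_num)]
  rw [binEnt, show (1 : ℝ) - 1 / 2 = 1 / 2 by norm_num, h]
  norm_num

/-- For every positive integer `d` there exists `q ∈ (0,1)` with
`2^{h(q) + q^d} · binomial(2d, d)^{1/(2d)} > 3.6`. -/
theorem stmt19 (d : ℕ) (hd : 1 ≤ d) :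
    ∃ q : ℝ, 0 < q ∧ q < 1 ∧
      (2 : ℝ) ^ (binEnt q + q ^ d) * ((Nat.choose (2 * d) d : ℝ)) ^ ((1 : ℝ) / (2 * d))
        > 3.6 := by
  rcases le_or_gt 8 d with h8 | h8
  · refine ⟨1 / 2, by norm_num, by norm_num, ?_⟩
    have hd' : (0 : ℝ) < d := by exact_mod_cast hd
    have h2 : (2 : ℝ) ≤ 2 ^ (binEnt (1 / 2) + (1 / 2) ^ d) := by
      rw [binEnt_half]
      refine Real.self_le_rpow_of_one_le (by norm_num) ?_
      have : (0 : ℝ) < (1 / 2) ^ d := by positivity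
      linarith
    have hroot : (1.8 : ℝ) < ((2 * d).choose d : ℝ) ^ ((1 : ℝ) / (2 * d)) := by
      rw [one_div, Real.lt_rpow_inv_iff_of_pos (by norm_num) (by positivity) (by positivity)]
      have := pow_lt_centralBinom d h8
      rw [Nat.centralBinom_eq_two_mul_choose] at this
      rw [Real.rpow_mul (by norm_num), Real.rpow_natCast]
      norm_num at this ⊢
      exact this
    nlinarith
  · interval_cases d
    · exact binEnt_witness_of_pow_lt 1 1 1 1 1 1 (by norm_num) (by norm_num) (by norm_num)
        (by norm_num) (by norm_num) (by norm_num) (by norm_num [Nat.choose])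
    · exact binEnt_witness_of_pow_lt 2 3 1 2 1 1 (by norm_num) (by norm_num) (by norm_num)
        (by norm_num) (by norm_num) (by norm_num) (by norm_num [Nat.choose])
    · exact binEnt_witness_of_pow_lt 3 5 1 3 1 1 (by norm_num) (by norm_num) (by norm_num)
        (by norm_num) (by norm_num) (by norm_num) (by norm_num [Nat.choose])
    · exact binEnt_witness_of_pow_lt 4 7 1 9 2 2 (by norm_num) (by norm_num) (by norm_num)
        (by norm_num) (by norm_num) (by norm_num) (by norm_num [Nat.choose])
    · exact binEnt_witness_of_pow_lt 5 14 1 21 2 3 (by norm_num) (by norm_num) (by norm_num)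
        (by norm_num) (by norm_num) (by norm_num) (by norm_num [Nat.choose])
    · exact binEnt_witness_of_pow_lt 6 35 1 152 5 15 (by norm_num) (by norm_num) (by norm_num)
        (by norm_num) (by norm_num) (by norm_num) (by norm_num [Nat.choose])
    · exact binEnt_witness_of_pow_lt 7 83 1 77 1 6 (by norm_num) (by norm_num) (by norm_num)
        (by norm_num) (by norm_num) (by norm_num) (by norm_num [Nat.choose])
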